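/- arXiv:2312.13167 — 2 statements merged into one kernel-verified Lean document; each statement's English description precedes it below -/
import Mathlib

section
/- Let v : ℝⁿ → ℝ be a 1-Lipschitz function (with respect to the Euclidean metric) and let μ, ν be Borel probability measures on ℝⁿ, absolutely continuous with respect to Lebesgue measure, with finite first moments. Let 𝓕 = {λ·(v − u) : λ ≥ 0, u : ℝⁿ → ℝ is 1-Lipschitz}, regarded as a subset of L¹(μ + ν). Let A ⊆ ℝⁿ be a Borel set which is a union of transport rays of v, i.e. there is a collection R of transport rays of v with A = ⋃R. Then both the indicator function 1_A and −1_A belong to the closure of 𝓕 in L¹(μ + ν): for every ε > 0 there exist λ, λ' ≥ 0 and 1-Lipschitz functions u, u' : ℝⁿ → ℝ with ∫ |λ·(v − u) − 1_A| d(μ + ν) < ε and ∫ |λ'·(v − u') + 1_A| d(μ + ν) < ε. -/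
open MeasureTheory

/-- A transport ray of a 1-Lipschitz function `v`: a maximal set on which `v` is an
isometry. -/
def IsTransportRay {n : ℕ} (v : EuclideanSpace ℝ (Fin n) → ℝ)
    (T : Set (EuclideanSpace ℝ (Fin n))) : Prop :=
  (∀ x ∈ T, ∀ y ∈ T, |v x - v y| = ‖x - y‖) ∧
  ∀ T' : Set (EuclideanSpace ℝ (Fin n)), T ⊆ T' →
    (∀ x ∈ T', ∀ y ∈ T', |v x - v y| = ‖x - y‖) → T' = T

/-- If a `1`-Lipschitz function preserves the distance between `x` and `y`, its derivative at `x`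
in the direction `y - x` is the increment `v y - v x`. -/
theorem fderiv_sub_eq_of_abs_sub_eq {E : Type*} [NormedAddCommGroup E] [NormedSpace ℝ E]
    {v : E → ℝ} (hv : LipschitzWith 1 v) {x y : E} (hx : DifferentiableAt ℝ v x)
    (h : |v x - v y| = ‖x - y‖) : fderiv ℝ v x (y - x) = v y - v x := by
  have haff : ∀ t ∈ Set.Icc (0 : ℝ) 1, v (x + t • (y - x)) = v x + t * (v y - v x) := by
    intro t ht
    have h1 : |v (x + t • (y - x)) - v x| ≤ t * ‖x - y‖ := by
      have := hv.dist_le_mul (x + t • (y - x)) x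
      rwa [NNReal.coe_one, one_mul, Real.dist_eq, dist_eq_norm, add_sub_cancel_left, norm_smul,
        Real.norm_of_nonneg ht.1, norm_sub_rev y x] at this
    have h2 : |v y - v (x + t • (y - x))| ≤ (1 - t) * ‖x - y‖ := by
      have := hv.dist_le_mul y (x + t • (y - x))
      rwa [NNReal.coe_one, one_mul, Real.dist_eq, dist_eq_norm,
        show y - (x + t • (y - x)) = (1 - t) • (y - x) by module, norm_smul,
        Real.norm_of_nonneg (sub_nonneg.2 ht.2), norm_sub_rev y x] at this
    rw [abs_le] at h1 h2
    rcases abs_choice (v x - v y) with hc | hc <;> rw [hc] at h <;> rw [← h] at h1 h2 <;> linarith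
  have hline : HasDerivAt (fun t : ℝ => x + t • (y - x)) (y - x) 0 := by
    simpa using ((hasDerivAt_id (0 : ℝ)).smul_const (y - x)).const_add x
  have hcomp : HasDerivAt (fun t : ℝ => v (x + t • (y - x))) (fderiv ℝ v x (y - x)) 0 :=
    HasFDerivAt.comp_hasDerivAt (0 : ℝ) (by simpa using hx.hasFDerivAt) hline
  have haffD : HasDerivAt (fun t : ℝ => v x + t * (v y - v x)) (v y - v x) 0 := by
    simpa using ((hasDerivAt_id (0 : ℝ)).mul_const (v y - v x)).const_add (v x)
  have huniq : UniqueDiffWithinAt ℝ (Set.Icc (0 : ℝ) 1) 0 :=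
    uniqueDiffOn_Icc_zero_one 0 (by simp)
  exact huniq.eq_deriv _ hcomp.hasDerivWithinAt
    (haffD.hasDerivWithinAt.congr haff (haff 0 (by simp)))

/-- At a point of differentiability, the points at which a `1`-Lipschitz function attains slope one
all lie on the line spanned by the gradient. -/
theorem sub_eq_smul_gradient_of_abs_sub_eq {E : Type*} [NormedAddCommGroup E]
    [InnerProductSpace ℝ E] [CompleteSpace E] {v : E → ℝ} (hv : LipschitzWith 1 v) {x y : E}
    (hx : DifferentiableAt ℝ v x) (h : |v x - v y| = ‖x - y‖) :
    y - x = (v y - v x) • gradient v x := by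
  have hin : inner ℝ (gradient v x) (y - x) = v y - v x := by
    rw [gradient, InnerProductSpace.toDual_symm_apply]
    exact fderiv_sub_eq_of_abs_sub_eq hv hx h
  have hle : ‖gradient v x‖ ≤ 1 := by
    rw [gradient, LinearIsometryEquiv.norm_map]
    exact norm_fderiv_le_of_lipschitz ℝ hv
  have hsq : ‖y - x‖ ^ 2 = (v y - v x) ^ 2 := by
    rw [norm_sub_rev, ← h, sq_abs]; ring
  have hnorm : ‖y - x - (v y - v x) • gradient v x‖ ^ 2 ≤ 0 := by
    rw [norm_sub_sq_real, real_inner_smul_right, real_inner_comm, hin, norm_smul, mul_pow,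
      Real.norm_eq_abs, sq_abs, hsq]
    have : ‖gradient v x‖ ^ 2 ≤ 1 := pow_le_one₀ (norm_nonneg _) hle
    nlinarith [sq_nonneg (v y - v x)]
  exact sub_eq_zero.1 (norm_eq_zero.1 (pow_eq_zero_iff two_ne_zero |>.1
    (le_antisymm hnorm (sq_nonneg _))))

/-- A transport ray through a point of differentiability contains every point at which the function
attains slope one. -/
theorem IsTransportRay.mem_of_abs_sub_eq {n : ℕ} {v : EuclideanSpace ℝ (Fin n) → ℝ}
    (hv : LipschitzWith 1 v) {T : Set (EuclideanSpace ℝ (Fin n))} (hT : IsTransportRay v T)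
    {x y : EuclideanSpace ℝ (Fin n)} (hx : DifferentiableAt ℝ v x) (hxT : x ∈ T)
    (h : |v x - v y| = ‖x - y‖) : y ∈ T := by
  have hy : ∀ z ∈ T, |v y - v z| = ‖y - z‖ := by
    intro z hz
    refine le_antisymm (by simpa [Real.dist_eq, dist_eq_norm] using hv.dist_le_mul y z) ?_
    have hle : ‖gradient v x‖ ≤ 1 := by
      rw [gradient, LinearIsometryEquiv.norm_map]
      exact norm_fderiv_le_of_lipschitz ℝ hv
    have hyz : y - z = (v y - v z) • gradient v x := by
      rw [← sub_sub_sub_cancel_right y z x, sub_eq_smul_gradient_of_abs_sub_eq hv hx h,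
        sub_eq_smul_gradient_of_abs_sub_eq hv hx (hT.1 x hxT z hz)]
      module
    rw [hyz, norm_smul, Real.norm_eq_abs]
    exact mul_le_of_le_one_right (abs_nonneg _) hle
  rw [← hT.2 (insert y T) (Set.subset_insert y T) ?_]
  · exact Set.mem_insert y T
  · rintro a (rfl | ha) b (rfl | hb)
    · simp
    · exact hy b hb
    · rw [abs_sub_comm, norm_sub_rev]
      exact hy a ha
    · exact hT.1 a ha b hb

/-- If a `1`-Lipschitz function `v` is strictly contracting between almost every point of `A` and
every point outside `A`, then the indicator of `A` is an `L¹`-limit of multiples of differences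
`v - u` with `u` `1`-Lipschitz. -/
theorem LipschitzWith.exists_integral_abs_mul_sub_indicator_lt {X : Type*} [MetricSpace X]
    [MeasurableSpace X] [BorelSpace X] (ρ : Measure X) [IsFiniteMeasure ρ]
    [ρ.InnerRegularCompactLTTop] {v : X → ℝ} (hv : LipschitzWith 1 v) {A : Set X}
    (hA : MeasurableSet A) (hlt : ∀ᵐ x ∂ρ, x ∈ A → ∀ y ∉ A, |v x - v y| < dist x y)
    {ε : ℝ} (hε : 0 < ε) :
    ∃ l ≥ (0 : ℝ), ∃ u : X → ℝ, LipschitzWith 1 u ∧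
      ∫ x, |l * (v x - u x) - A.indicator (fun _ => (1 : ℝ)) x| ∂ρ < ε := by
  set N := toMeasurable ρ {x | ¬ (x ∈ A → ∀ y ∉ A, |v x - v y| < dist x y)} with hN
  have hN0 : ρ N = 0 := by rw [hN, measure_toMeasurable]; exact hlt
  have hNgood : ∀ x ∉ N, x ∈ A → ∀ y ∉ A, |v x - v y| < dist x y := by
    intro x hx
    by_contra hc
    exact hx (subset_toMeasurable ρ _ hc)
  have hε2 : ENNReal.ofReal (ε / 2) ≠ 0 := by simpa using hε
  obtain ⟨K, hKA, hK, hρK⟩ := (hA.diff (measurableSet_toMeasurable ρ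
    {x | ¬ (x ∈ A → ∀ y ∉ A, |v x - v y| < dist x y)})).exists_isCompact_sdiff_lt
    (measure_ne_top ρ _) hε2
  obtain ⟨L, hLA, hL, hρL⟩ := hA.compl.exists_isCompact_sdiff_lt (measure_ne_top ρ _) hε2
  obtain ⟨δ, hδ, hδKL⟩ : ∃ δ > (0 : ℝ), ∀ p ∈ K ×ˢ L, δ ≤ dist p.1 p.2 - |v p.1 - v p.2| := by
    refine (hK.prod hL).exists_forall_le' (Continuous.continuousOn ?_) ?_
    · have := hv.continuous
      fun_prop
    · intro p hp
      exact sub_pos.2 (hNgood p.1 (hKA hp.1).2 (hKA hp.1).1 p.2 (hLA hp.2))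
  have hvd : ∀ x y, |v x - v y| ≤ dist x y := fun x y => by
    simpa [Real.dist_eq] using hv.dist_le_mul x y
  have hLip : LipschitzOnWith 1 (fun x => v x - A.indicator (fun _ => δ) x) (K ∪ L) := by
    refine LipschitzOnWith.of_dist_le_mul fun x hx y hy => ?_
    rw [NNReal.coe_one, one_mul, Real.dist_eq]
    rcases hx with hx | hx <;> rcases hy with hy | hy
    · simpa [(hKA hx).1, (hKA hy).1] using hvd x y
    · have h1 := hδKL (x, y) ⟨hx, hy⟩
      have h2 : y ∉ A := hLA hy
      simp only [Set.indicator_of_mem (hKA hx).1, Set.indicator_of_notMem h2]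
      dsimp only at h1
      have := le_abs_self (v x - v y)
      have := neg_abs_le (v x - v y)
      exact abs_le.2 ⟨by linarith, by linarith⟩
    · have h1 := hδKL (y, x) ⟨hy, hx⟩
      have h2 : x ∉ A := hLA hx
      simp only [Set.indicator_of_mem (hKA hy).1, Set.indicator_of_notMem h2]
      dsimp only at h1
      rw [dist_comm, abs_sub_comm] at h1
      have := le_abs_self (v x - v y)
      have := neg_abs_le (v x - v y)
      exact abs_le.2 ⟨by linarith, by linarith⟩
    · have h1 : x ∉ A := hLA hx
      have h2 : y ∉ A := hLA hy
      simpa [h1, h2] using hvd x y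
  obtain ⟨u₀, hu₀, hu₀eq⟩ := hLip.extend_real
  have hvδ : LipschitzWith 1 (fun x => v x - δ) := by
    refine LipschitzWith.of_dist_le_mul fun x y => ?_
    simpa using hv.dist_le_mul x y
  have hu : LipschitzWith 1 (fun x => max (min (u₀ x) (v x)) (v x - δ)) := by
    simpa using (hu₀.min hv).max hvδ
  refine ⟨δ⁻¹, (inv_pos.2 hδ).le, _, hu, ?_⟩
  set S := (K ∪ L)ᶜ with hS
  have hSm : MeasurableSet S := (hK.isClosed.measurableSet.union hL.isClosed.measurableSet).compl
  have hSρ : ρ.real S < ε := by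
    have hsub : S ⊆ N ∪ ((A \ N) \ K ∪ Aᶜ \ L) := by
      intro x hx
      simp only [hS, Set.mem_compl_iff, Set.mem_union, not_or] at hx
      by_cases hxN : x ∈ N
      · exact Or.inl hxN
      · by_cases hxA : x ∈ A
        · exact Or.inr (Or.inl ⟨⟨hxA, hxN⟩, hx.1⟩)
        · exact Or.inr (Or.inr ⟨hxA, hx.2⟩)
    have : ρ S < ENNReal.ofReal ε := calc
      ρ S ≤ ρ N + (ρ ((A \ N) \ K) + ρ (Aᶜ \ L)) :=
        (measure_mono hsub).trans ((measure_union_le _ _).trans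
          (by gcongr; exact measure_union_le _ _))
      _ < ENNReal.ofReal (ε / 2) + ENNReal.ofReal (ε / 2) := by
        rw [hN0, zero_add]
        exact ENNReal.add_lt_add hρK hρL
      _ = ENNReal.ofReal ε := by
        rw [← ENNReal.ofReal_add (by positivity) (by positivity), add_halves]
    exact (ENNReal.lt_ofReal_iff_toReal_lt (measure_ne_top ρ S)).1 this
  refine lt_of_le_of_lt ?_ hSρ
  rw [← integral_indicator_one hSm]
  refine integral_mono_of_nonneg (.of_forall fun x => abs_nonneg _)
    ((integrable_const (1 : ℝ)).indicator hSm) (.of_forall fun x => ?_)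
  dsimp only
  by_cases hx : x ∈ S
  · rw [Set.indicator_of_mem hx, Pi.one_apply]
    have h0 : 0 ≤ δ⁻¹ * (v x - max (min (u₀ x) (v x)) (v x - δ)) :=
      mul_nonneg (inv_pos.2 hδ).le
        (sub_nonneg.2 (max_le (min_le_right _ _) (by linarith)))
    have h1 : δ⁻¹ * (v x - max (min (u₀ x) (v x)) (v x - δ)) ≤ 1 := by
      rw [inv_mul_le_one₀ hδ]
      linarith [le_max_right (min (u₀ x) (v x)) (v x - δ)]
    by_cases hxA : x ∈ A
    · rw [Set.indicator_of_mem hxA]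
      exact abs_le.2 ⟨by linarith, by linarith⟩
    · rw [Set.indicator_of_notMem hxA]
      exact abs_le.2 ⟨by linarith, by linarith⟩
  · rw [Set.indicator_of_notMem hx]
    have hxKL : x ∈ K ∪ L := not_not.1 hx
    rw [← hu₀eq hxKL]
    by_cases hxA : x ∈ A
    · simp only [Set.indicator_of_mem hxA]
      rw [min_eq_left (by linarith), max_self, sub_sub_cancel, inv_mul_cancel₀ hδ.ne', sub_self,
        abs_zero]
    · simp only [Set.indicator_of_notMem hxA]
      rw [sub_zero, sub_zero, min_self, max_eq_left (by linarith)]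
      simp

/-- If `A` is a Borel union of transport rays of a 1-Lipschitz function `v`,
then both `1_A` and `−1_A` lie in the `L¹(μ+ν)`-closure of the cone
`𝓕 = {λ(v − u) : λ ≥ 0, u 1-Lipschitz}`. -/
theorem stmt_15 {n : ℕ} (v : EuclideanSpace ℝ (Fin n) → ℝ) (hv : LipschitzWith 1 v)
    (μ ν : Measure (EuclideanSpace ℝ (Fin n)))
    [IsProbabilityMeasure μ] [IsProbabilityMeasure ν]
    (hμac : μ ≪ (volume : Measure (EuclideanSpace ℝ (Fin n))))
    (hνac : ν ≪ (volume : Measure (EuclideanSpace ℝ (Fin n))))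
    (hμm : Integrable (fun x => ‖x‖) μ) (hνm : Integrable (fun x => ‖x‖) ν)
    (A : Set (EuclideanSpace ℝ (Fin n))) (hA : MeasurableSet A)
    (hAuni : ∃ R : Set (Set (EuclideanSpace ℝ (Fin n))),
      (∀ T ∈ R, IsTransportRay v T) ∧ A = ⋃₀ R) :
    ∀ ε > (0:ℝ),
      (∃ l ≥ (0:ℝ), ∃ u : EuclideanSpace ℝ (Fin n) → ℝ, LipschitzWith 1 u ∧
        ∫ x, |l * (v x - u x) - A.indicator (fun _ => (1:ℝ)) x| ∂(μ + ν) < ε) ∧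
      (∃ l ≥ (0:ℝ), ∃ u : EuclideanSpace ℝ (Fin n) → ℝ, LipschitzWith 1 u ∧
        ∫ x, |l * (v x - u x) + A.indicator (fun _ => (1:ℝ)) x| ∂(μ + ν) < ε) := by
  obtain ⟨R, hR, rfl⟩ := hAuni
  intro ε hε
  have hac : μ + ν ≪ (volume : Measure (EuclideanSpace ℝ (Fin n))) :=
    Measure.AbsolutelyContinuous.add_left hμac hνac
  have hlt : ∀ᵐ x ∂(μ + ν), x ∈ ⋃₀ R → ∀ y ∉ ⋃₀ R, |v x - v y| < dist x y := by
    filter_upwards [hac.ae_le hv.ae_differentiableAt] with x hx hxA y hy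
    obtain ⟨T, hTR, hxT⟩ := hxA
    rw [dist_eq_norm]
    refine lt_of_le_of_ne (by simpa [Real.dist_eq, dist_eq_norm] using hv.dist_le_mul x y) ?_
    intro h
    exact hy ⟨T, hTR, (hR T hTR).mem_of_abs_sub_eq hv hx hxT h⟩
  refine ⟨hv.exists_integral_abs_mul_sub_indicator_lt (μ + ν) hA hlt hε, ?_⟩
  have hlt' : ∀ᵐ x ∂(μ + ν), x ∈ ⋃₀ R → ∀ y ∉ ⋃₀ R, |(-v) x - (-v) y| < dist x y := by
    filter_upwards [hlt] with x hx hxA y hy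
    rw [Pi.neg_apply, Pi.neg_apply, neg_sub_neg, abs_sub_comm]
    exact hx hxA y hy
  obtain ⟨l, hl, u, hu, hint⟩ :=
    hv.neg.exists_integral_abs_mul_sub_indicator_lt (μ + ν) hA hlt' hε
  refine ⟨l, hl, -u, hu.neg, lt_of_eq_of_lt (integral_congr_ae (.of_forall fun x => ?_)) hint⟩
  dsimp only [Pi.neg_apply]
  rw [← abs_neg]
  congr 1
  ring
end

section
/- Let v : ℝⁿ → ℝ be a 1-Lipschitz function (with respect to the Euclidean metric) and let μ, ν be Borel probability measures on ℝⁿ, absolutely continuous with respect to Lebesgue measure, with finite first moments. Let 𝓕 = {λ·(v − u) : λ ≥ 0, u : ℝⁿ → ℝ is 1-Lipschitz}, regarded as a subset of L¹(μ + ν). Then every Borel measurable function f : ℝⁿ → ℝ which is integrable with respect to μ + ν and constant on every transport ray of v belongs to cl𝓕 ∩ (−cl𝓕), where cl𝓕 denotes the closure of 𝓕 in L¹(μ + ν); that is, both f and −f are L¹(μ+ν)-limits of functions of the form λ·(v − u) with λ ≥ 0 and u 1-Lipschitz. -/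
open MeasureTheory

/-- Any two points at which `v` realizes their distance lie on a common transport ray. -/
lemma exists_isTransportRay_of_abs_sub_eq {n : ℕ} {v : EuclideanSpace ℝ (Fin n) → ℝ}
    {x y : EuclideanSpace ℝ (Fin n)} (h : |v x - v y| = ‖x - y‖) :
    ∃ T, IsTransportRay v T ∧ x ∈ T ∧ y ∈ T := by
  obtain ⟨T, hxy, hT⟩ := zorn_subset_nonempty
    {T : Set (EuclideanSpace ℝ (Fin n)) | ∀ a ∈ T, ∀ b ∈ T, |v a - v b| = ‖a - b‖}
    (by
      intro c hc hchain _
      refine ⟨⋃₀ c, ?_, fun s hs => Set.subset_sUnion_of_mem hs⟩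
      rintro a ⟨s, hs, has⟩ b ⟨t, ht, hbt⟩
      rcases hchain.total hs ht with hst | hts
      · exact hc ht a (hst has) b hbt
      · exact hc hs a has b (hts hbt))
    {x, y}
    (by
      have h' : |v y - v x| = ‖y - x‖ := by rw [abs_sub_comm, h, norm_sub_rev]
      rintro a (rfl | rfl) b (rfl | rfl) <;> simp [h, h'])
  exact ⟨T, ⟨hT.prop, fun T' hTT' hT' => (hT.eq_of_subset hT' hTT').symm⟩,
    hxy (by simp), hxy (by simp)⟩

section MetricSpace

open scoped ENNReal

variable {E : Type*} [MetricSpace E]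

/-- If a bounded function `g` is such that `v - t * g` is `1`-Lipschitz on `K`, then `t * g`
agrees on `K` with some `v - u`, where `u` is `1`-Lipschitz and `v - u` obeys the bound of
`t * g` globally. -/
lemma LipschitzWith.exists_sub_eqOn_of_lipschitzOnWith_sub {v g : E → ℝ}
    (hv : LipschitzWith 1 v) {M t : ℝ} (ht : 0 < t) (hM : ∀ x, |g x| ≤ M) {K : Set E}
    (hK : LipschitzOnWith 1 (fun x => v x - t * g x) K) :
    ∃ u : E → ℝ, LipschitzWith 1 u ∧ (∀ x, |v x - u x| ≤ t * M) ∧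
      ∀ x ∈ K, v x - u x = t * g x := by
  obtain ⟨w, hw, hwK⟩ := hK.extend_real
  have hadd (c : ℝ) : LipschitzWith 1 (fun x => v x + c) := by
    simpa using hv.add (LipschitzWith.const c)
  refine ⟨fun x => max (min (w x) (v x + t * M)) (v x + -(t * M)), ?_, fun x => ?_,
    fun x hx => ?_⟩
  · simpa using (hw.min (hadd (t * M))).max (hadd (-(t * M)))
  · have hM0 : 0 ≤ t * M := mul_nonneg ht.le ((abs_nonneg _).trans (hM x))
    have h₁ := le_max_right (min (w x) (v x + t * M)) (v x + -(t * M))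
    have h₂ : max (min (w x) (v x + t * M)) (v x + -(t * M)) ≤ v x + t * M :=
      max_le (min_le_right _ _) (by linarith)
    rw [abs_le]
    constructor <;> linarith
  · have hle : |t * g x| ≤ t * M := by
      rw [abs_mul, abs_of_pos ht]
      exact mul_le_mul_of_nonneg_left (hM x) ht.le
    rw [abs_le] at hle
    have hwx : v x - t * g x = w x := hwK hx
    dsimp only
    rw [min_eq_left (by linarith), max_eq_left (by linarith)]
    linarith

/-- Perturbing a `1`-Lipschitz function by a small multiple of a function that is constant on
each of finitely many compact sets, and only jumps between points where the Lipschitz bound is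
strict, keeps it `1`-Lipschitz on their union. -/
lemma LipschitzWith.exists_pos_lipschitzOnWith_sub {v g : E → ℝ} (hv : LipschitzWith 1 v)
    (hg : ∀ x y, |v x - v y| = dist x y → g x = g y) {M : ℝ} (hM : ∀ x, |g x| ≤ M)
    {s : Finset ℝ} {K : ℝ → Set E} (hKc : ∀ i, IsCompact (K i))
    (hKg : ∀ i, ∀ x ∈ K i, g x = i) :
    ∃ t > 0, LipschitzOnWith 1 (fun x => v x - t * g x) (⋃ i ∈ s, K i) := by
  have hvd (x y : E) : |v x - v y| ≤ dist x y := by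
    simpa [Real.dist_eq] using hv.dist_le_mul x y
  have hC : IsCompact (⋃ p ∈ s.offDiag, K p.1 ×ˢ K p.2) :=
    s.offDiag.isCompact_biUnion fun p _ => (hKc p.1).prod (hKc p.2)
  have hcont : Continuous fun p : E × E => dist p.1 p.2 - |v p.1 - v p.2| := by
    have := hv.continuous
    fun_prop
  obtain ⟨c, hc, hcle⟩ := hC.exists_forall_le' (a := 0) hcont.continuousOn (by
    intro p hp
    simp only [Set.mem_iUnion, Finset.mem_offDiag, Set.mem_prod] at hp
    obtain ⟨q, ⟨-, -, hq⟩, h₁, h₂⟩ := hp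
    refine sub_pos.2 ((hvd _ _).lt_of_ne fun h => hq ?_)
    rw [← hKg _ _ h₁, ← hKg _ _ h₂, hg _ _ h])
  obtain ⟨t, ht, htc⟩ := exists_pos_mul_lt hc (2 * M)
  refine ⟨t, ht, LipschitzOnWith.of_dist_le_mul fun x hx y hy => ?_⟩
  simp only [Set.mem_iUnion] at hx hy
  obtain ⟨i, hi, hxi⟩ := hx
  obtain ⟨j, hj, hyj⟩ := hy
  rw [NNReal.coe_one, one_mul, Real.dist_eq]
  have heq : v x - t * g x - (v y - t * g y) = (v x - v y) - t * (g x - g y) := by ring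
  rw [heq]
  by_cases hij : i = j
  · rw [hKg i x hxi, hKg j y hyj, hij]
    simpa using hvd x y
  · have hgap := hcle (x, y) (by
      simp only [Set.mem_iUnion, Finset.mem_offDiag, Set.mem_prod]
      exact ⟨(i, j), ⟨hi, hj, hij⟩, hxi, hyj⟩)
    have hjump : |t * (g x - g y)| ≤ t * (2 * M) := by
      rw [abs_mul, abs_of_pos ht]
      exact mul_le_mul_of_nonneg_left
        ((abs_sub _ _).trans (by linarith [hM x, hM y])) ht.le
    have := abs_sub (v x - v y) (t * (g x - g y))
    dsimp only at hgap
    linarith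

variable [MeasurableSpace E] [BorelSpace E]

/-- A simple function which agrees at any two points where the `1`-Lipschitz function `v`
realizes their distance is an `L¹`-limit of functions `l * (v - u)`, with `l ≥ 0` and `u`
`1`-Lipschitz. -/
lemma LipschitzWith.exists_eLpNorm_mul_sub_sub_simpleFunc_lt {v : E → ℝ}
    (hv : LipschitzWith 1 v) (m : Measure E) [IsFiniteMeasure m] [m.InnerRegularCompactLTTop]
    (g : SimpleFunc E ℝ) (hg : ∀ x y, |v x - v y| = dist x y → g x = g y)
    {ε : ℝ≥0∞} (hε : ε ≠ 0) :
    ∃ l ≥ (0 : ℝ), ∃ u : E → ℝ, LipschitzWith 1 u ∧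
      eLpNorm (fun x => l * (v x - u x) - g x) 1 m < ε := by
  obtain ⟨M, hM⟩ := g.exists_forall_norm_le
  simp only [Real.norm_eq_abs] at hM
  obtain ⟨δ, hδ, hδε⟩ := ENNReal.exists_pos_mul_lt
    (a := g.range.card * ENNReal.ofReal (2 * M)) (by finiteness) hε
  have hcpt (i : ℝ) : ∃ K ⊆ g ⁻¹' {i}, IsCompact K ∧ m (g ⁻¹' {i} \ K) < δ :=
    (g.measurableSet_fiber i).exists_isCompact_sdiff_lt (measure_ne_top _ _) hδ.ne'
  choose K hKsub hKc hKm using hcpt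
  have hKg (i : ℝ) (x : E) (hx : x ∈ K i) : g x = i := hKsub i hx
  obtain ⟨t, ht, hlip⟩ := hv.exists_pos_lipschitzOnWith_sub (s := g.range) hg hM hKc hKg
  obtain ⟨u, hu, hbound, heq⟩ := hv.exists_sub_eqOn_of_lipschitzOnWith_sub ht hM hlip
  refine ⟨t⁻¹, by positivity, u, hu, ?_⟩
  set C := ⋃ i ∈ g.range, K i with hC_def
  have hCm : MeasurableSet Cᶜ :=
    (g.range.measurableSet_biUnion fun i _ => (hKc i).measurableSet).compl
  have hCδ : m Cᶜ ≤ g.range.card * δ := by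
    have hsub : Cᶜ ⊆ ⋃ i ∈ g.range, g ⁻¹' {i} \ K i := by
      intro x hx
      simp only [hC_def, Set.mem_compl_iff, Set.mem_iUnion, not_exists] at hx
      have hgx := g.mem_range_self x
      simp only [Set.mem_iUnion]
      exact ⟨g x, hgx, rfl, hx _ hgx⟩
    calc m Cᶜ ≤ ∑ i ∈ g.range, m (g ⁻¹' {i} \ K i) :=
          (measure_mono hsub).trans (measure_biUnion_finset_le _ _)
      _ ≤ ∑ _i ∈ g.range, δ := Finset.sum_le_sum fun i _ => (hKm i).le
      _ = g.range.card * δ := by simp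
  have hpt (x : E) : ‖t⁻¹ * (v x - u x) - g x‖ₑ
      ≤ Cᶜ.indicator (fun _ => ENNReal.ofReal (2 * M)) x := by
    by_cases hx : x ∈ C
    · simp [heq x hx, ht.ne', hx]
    · rw [Set.indicator_of_mem (show x ∈ Cᶜ from hx), Real.enorm_eq_ofReal_abs]
      refine ENNReal.ofReal_le_ofReal ((abs_sub _ _).trans ?_)
      have : |t⁻¹ * (v x - u x)| ≤ M := by
        rw [abs_mul, abs_of_pos (inv_pos.2 ht), inv_mul_le_iff₀ ht]
        exact hbound x
      linarith [hM x]
  calc eLpNorm (fun x => t⁻¹ * (v x - u x) - g x) 1 m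
      = ∫⁻ x, ‖t⁻¹ * (v x - u x) - g x‖ₑ ∂m := eLpNorm_one_eq_lintegral_enorm
    _ ≤ ∫⁻ x, Cᶜ.indicator (fun _ => ENNReal.ofReal (2 * M)) x ∂m := lintegral_mono hpt
    _ = ENNReal.ofReal (2 * M) * m Cᶜ := lintegral_indicator_const hCm _
    _ ≤ ENNReal.ofReal (2 * M) * (g.range.card * δ) := by gcongr
    _ = δ * (g.range.card * ENNReal.ofReal (2 * M)) := by ring
    _ < ε := hδε

/-- An integrable function which agrees at any two points where the `1`-Lipschitz function `v`
realizes their distance is an `L¹`-limit of functions `l * (v - u)`, with `l ≥ 0` and `u`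
`1`-Lipschitz. -/
lemma LipschitzWith.exists_integral_abs_mul_sub_sub_lt {v : E → ℝ} (hv : LipschitzWith 1 v)
    (m : Measure E) [IsFiniteMeasure m] [m.InnerRegularCompactLTTop]
    {f : E → ℝ} (hfm : Measurable f) (hfi : Integrable f m)
    (hf : ∀ x y, |v x - v y| = dist x y → f x = f y) {ε : ℝ} (hε : 0 < ε) :
    ∃ l ≥ (0 : ℝ), ∃ u : E → ℝ, LipschitzWith 1 u ∧ ∫ x, |l * (v x - u x) - f x| ∂m < ε := by
  have hε' : ENNReal.ofReal (ε / 2) ≠ 0 := by simpa using hε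
  have hid : MemLp (id : ℝ → ℝ) 1 (m.map f) :=
    (memLp_map_measure_iff aestronglyMeasurable_id hfm.aemeasurable).2
      (memLp_one_iff_integrable.2 hfi)
  obtain ⟨φ, hφ, -⟩ := hid.exists_simpleFunc_eLpNorm_sub_lt ENNReal.one_ne_top hε'
  rw [eLpNorm_map_measure (aestronglyMeasurable_id.sub φ.aestronglyMeasurable)
    hfm.aemeasurable] at hφ
  obtain ⟨l, hl, u, hu, hlu⟩ := hv.exists_eLpNorm_mul_sub_sub_simpleFunc_lt m (φ.comp f hfm)
    (fun x y h => by simp [hf x y h]) hε'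
  refine ⟨l, hl, u, hu, ?_⟩
  have hvm := hv.continuous.measurable
  have hum := hu.continuous.measurable
  have hlt : eLpNorm (fun x => l * (v x - u x) - f x) 1 m < ENNReal.ofReal ε := by
    calc eLpNorm (fun x => l * (v x - u x) - f x) 1 m
        = eLpNorm ((fun x => l * (v x - u x) - φ.comp f hfm x) - (id - ⇑φ) ∘ f) 1 m := by
          congr 1
          ext x
          simp
      _ ≤ eLpNorm (fun x => l * (v x - u x) - φ.comp f hfm x) 1 m
          + eLpNorm ((id - ⇑φ) ∘ f) 1 m :=
          eLpNorm_sub_le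
            (((hvm.sub hum).const_mul l).sub (φ.comp f hfm).measurable).aestronglyMeasurable
            ((measurable_id.sub φ.measurable).comp hfm).aestronglyMeasurable le_rfl
      _ < ENNReal.ofReal (ε / 2) + ENNReal.ofReal (ε / 2) := ENNReal.add_lt_add hlu hφ
      _ = ENNReal.ofReal ε := by
          rw [← ENNReal.ofReal_add (by positivity) (by positivity), add_halves]
  have hmeas : AEStronglyMeasurable (fun x => l * (v x - u x) - f x) m :=
    (((hvm.sub hum).const_mul l).sub hfm).aestronglyMeasurable
  rw [eLpNorm_one_eq_lintegral_enorm] at hlt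
  simp only [← Real.norm_eq_abs]
  rw [integral_norm_eq_lintegral_enorm hmeas]
  exact ENNReal.toReal_lt_of_lt_ofReal hlt

end MetricSpace

/-- Every Borel function `f`, integrable with respect to `μ + ν` and constant on
every transport ray of `v`, belongs to `cl 𝓕 ∩ (－cl 𝓕)` where
`𝓕 = {λ(v − u) : λ ≥ 0, u 1-Lipschitz}` and the closure is taken in `L¹(μ + ν)`. -/
theorem stmt_16 {n : ℕ} (v : EuclideanSpace ℝ (Fin n) → ℝ) (hv : LipschitzWith 1 v)
    (μ ν : Measure (EuclideanSpace ℝ (Fin n)))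
    [IsProbabilityMeasure μ] [IsProbabilityMeasure ν]
    (hμac : μ ≪ (volume : Measure (EuclideanSpace ℝ (Fin n))))
    (hνac : ν ≪ (volume : Measure (EuclideanSpace ℝ (Fin n))))
    (hμm : Integrable (fun x => ‖x‖) μ) (hνm : Integrable (fun x => ‖x‖) ν)
    (f : EuclideanSpace ℝ (Fin n) → ℝ) (hfm : Measurable f)
    (hfi : Integrable f (μ + ν))
    (hfray : ∀ T : Set (EuclideanSpace ℝ (Fin n)), IsTransportRay v T →
      ∀ x ∈ T, ∀ y ∈ T, f x = f y) :
    ∀ ε > (0:ℝ),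
      (∃ l ≥ (0:ℝ), ∃ u : EuclideanSpace ℝ (Fin n) → ℝ, LipschitzWith 1 u ∧
        ∫ x, |l * (v x - u x) - f x| ∂(μ + ν) < ε) ∧
      (∃ l ≥ (0:ℝ), ∃ u : EuclideanSpace ℝ (Fin n) → ℝ, LipschitzWith 1 u ∧
        ∫ x, |l * (v x - u x) + f x| ∂(μ + ν) < ε) := by
  have hf (x y : EuclideanSpace ℝ (Fin n)) (h : |v x - v y| = dist x y) : f x = f y := by
    rw [dist_eq_norm] at h
    obtain ⟨T, hT, hx, hy⟩ := exists_isTransportRay_of_abs_sub_eq h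
    exact hfray T hT x hx y hy
  intro ε hε
  refine ⟨hv.exists_integral_abs_mul_sub_sub_lt (μ + ν) hfm hfi hf hε, ?_⟩
  simpa using hv.exists_integral_abs_mul_sub_sub_lt (μ + ν) hfm.neg hfi.neg
    (fun x y h => by simp [hf x y h]) hε
end
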